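/- arXiv:2004.05197 — 2 statements merged into one kernel-verified Lean document; each statement's English description precedes it below -/
import Mathlib

section
/- Let V be a complex vector space equipped with two seminorms |·|₁ and |·|₀, let k ≥ 0, and define the weighted norm ‖u‖_H = (|u|₁² + k²|u|₀²)^{1/2}. Let a, ã, m, m̃, b be sesquilinear forms on V and let ε₁, ε₂ ≥ 0 satisfy |a(u,v) − ã(u,v)| ≤ ε₁|u|₁|v|₁ and |m(u,v) − m̃(u,v)| ≤ ε₂|u|₀|v|₀ for all u, v ∈ V. Define 𝒜(u,v) = a(u,v) − k² m(u,v) − i k b(u,v) and 𝒜̃(u,v) = ã(u,v) − k² m̃(u,v) − i k b(u,v). Then |𝒜(u,v) − 𝒜̃(u,v)| ≤ max{ε₁, ε₂} · ‖u‖_H · ‖v‖_H for all u, v ∈ V; in particular the right-hand side does not depend on k. -/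
/-- Cauchy–Schwarz inequality in `ℝ²`, in coordinates. -/
theorem Real.mul_add_mul_le_sqrt_mul_sqrt (x₁ x₂ y₁ y₂ : ℝ) :
    x₁ * y₁ + x₂ * y₂ ≤ √(x₁ ^ 2 + x₂ ^ 2) * √(y₁ ^ 2 + y₂ ^ 2) := by
  rw [← Real.sqrt_mul (by positivity)]
  apply Real.le_sqrt_of_sq_le
  linarith [sq_nonneg (x₁ * y₂ - x₂ * y₁)]

/-- **Wave-number-independent surrogate perturbation bound.**
Let `V` be a complex vector space with two seminorms `n₁ = |·|₁` and
`n₀ = |·|₀`, let `k ≥ 0`, and set `‖u‖_H = √(|u|₁² + k²|u|₀²)`. Let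
`a, ã, m, m̃, b` be sesquilinear forms with
`|a(u,v) − ã(u,v)| ≤ ε₁|u|₁|v|₁` and `|m(u,v) − m̃(u,v)| ≤ ε₂|u|₀|v|₀`.
With `𝒜(u,v) = a(u,v) − k²m(u,v) − ik·b(u,v)` and the analogous `𝒜̃`,
one has `|𝒜(u,v) − 𝒜̃(u,v)| ≤ max{ε₁, ε₂}·‖u‖_H·‖v‖_H` — independently of `k`. -/
theorem surrogate_helmholtz_perturbation
    {V : Type*} [AddCommGroup V] [Module ℂ V]
    (n1 n0 : Seminorm ℂ V) (k : ℝ) (hk : 0 ≤ k)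
    (a ta m tm b : V →ₗ[ℂ] V →ₗ⋆[ℂ] ℂ)
    (ε1 ε2 : ℝ) (hε1 : 0 ≤ ε1) (hε2 : 0 ≤ ε2)
    (ha : ∀ u v : V, ‖a u v - ta u v‖ ≤ ε1 * n1 u * n1 v)
    (hm : ∀ u v : V, ‖m u v - tm u v‖ ≤ ε2 * n0 u * n0 v) :
    ∀ u v : V,
      ‖(a u v - (k : ℂ) ^ 2 * m u v - Complex.I * (k : ℂ) * b u v) -
          (ta u v - (k : ℂ) ^ 2 * tm u v - Complex.I * (k : ℂ) * b u v)‖ ≤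
        max ε1 ε2 * Real.sqrt ((n1 u) ^ 2 + k ^ 2 * (n0 u) ^ 2) *
          Real.sqrt ((n1 v) ^ 2 + k ^ 2 * (n0 v) ^ 2) := by
  intro u v
  have hsplit : (a u v - (k : ℂ) ^ 2 * m u v - Complex.I * (k : ℂ) * b u v) -
      (ta u v - (k : ℂ) ^ 2 * tm u v - Complex.I * (k : ℂ) * b u v) =
      (a u v - ta u v) - (k : ℂ) ^ 2 * (m u v - tm u v) := by ring
  have hk2 : ‖(k : ℂ) ^ 2‖ = k ^ 2 := by simp
  have hcs := Real.mul_add_mul_le_sqrt_mul_sqrt (n1 u) (k * n0 u) (n1 v) (k * n0 v)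
  simp only [mul_pow] at hcs
  have h1 : 0 ≤ n1 u * n1 v := mul_nonneg (apply_nonneg n1 u) (apply_nonneg n1 v)
  have h0 : 0 ≤ n0 u * n0 v := mul_nonneg (apply_nonneg n0 u) (apply_nonneg n0 v)
  rw [hsplit]
  calc ‖(a u v - ta u v) - (k : ℂ) ^ 2 * (m u v - tm u v)‖
      ≤ ‖a u v - ta u v‖ + k ^ 2 * ‖m u v - tm u v‖ := by
        rw [← hk2, ← Complex.norm_mul]
        exact norm_sub_le _ _
    _ ≤ ε1 * (n1 u * n1 v) + k ^ 2 * (ε2 * (n0 u * n0 v)) := by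
        simp only [← mul_assoc ε1, ← mul_assoc ε2]
        gcongr
        exacts [ha u v, hm u v]
    _ ≤ max ε1 ε2 * (n1 u * n1 v) + k ^ 2 * (max ε1 ε2 * (n0 u * n0 v)) := by
        gcongr
        exacts [le_max_left _ _, le_max_right _ _]
    _ = max ε1 ε2 * (n1 u * n1 v + k * n0 u * (k * n0 v)) := by ring
    _ ≤ max ε1 ε2 * (√((n1 u) ^ 2 + k ^ 2 * (n0 u) ^ 2) *
          √((n1 v) ^ 2 + k ^ 2 * (n0 v) ^ 2)) :=
        mul_le_mul_of_nonneg_left hcs (hε1.trans (le_max_left _ _))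
    _ = _ := (mul_assoc _ _ _).symm
end

section
/- Let V be a complex normed vector space and V_h ⊆ V a nontrivial finite-dimensional subspace. Let A and Ã be sesquilinear forms on V_h and F : V_h → ℂ a conjugate-linear functional. Suppose: (i) u ∈ V and u_h ∈ V_h satisfy A(u_h, v) = F(v) for all v ∈ V_h; (ii) γ̃ > 0 satisfies sup_{v ∈ V_h, v ≠ 0} |Ã(w,v)|/‖v‖ ≥ γ̃‖w‖ for all w ∈ V_h; (iii) ε ≥ 0 satisfies |A(w,v) − Ã(w,v)| ≤ ε‖w‖‖v‖ for all w, v ∈ V_h; and (iv) C_s ≥ 0 satisfies ‖u_h‖ ≤ C_s‖u‖. Then there exists a unique ũ_h ∈ V_h with Ã(ũ_h, v) = F(v) for all v ∈ V_h, and ‖u − ũ_h‖ ≤ ‖u − u_h‖ + (ε C_s / γ̃) ‖u‖. -/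
/-- An injective linear map from a finite-dimensional space to its conjugate-linear functionals
is surjective. -/
theorem LinearMap.surjective_of_injective_conjDual {E : Type*} [AddCommGroup E] [Module ℂ E]
    [FiniteDimensional ℂ E] (B : E →ₗ[ℂ] E →ₗ⋆[ℂ] ℂ) (hB : Function.Injective B) :
    Function.Surjective B := by
  intro F
  let b := Module.finBasis ℂ E
  let T : E →ₗ[ℂ] (Fin (Module.finrank ℂ E) → ℂ) := LinearMap.pi fun i => B.flip (b i)
  have hT : Function.Injective T := fun x y hxy =>
    hB (b.ext fun i => congrFun hxy i)
  have hT' : Function.Surjective T :=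
    (LinearMap.injective_iff_surjective_of_finrank_eq_finrank (by simp)).1 hT
  obtain ⟨w, hw⟩ := hT' fun i => F (b i)
  exact ⟨w, b.ext fun i => congrFun hw i⟩

/-- An inf-sup bound turns a bound on the functional `B w` into a bound on `w`. -/
theorem mul_norm_le_of_infsup {E : Type*} [NormedAddCommGroup E] [NormedSpace ℂ E] [Nontrivial E]
    {B : E →ₗ[ℂ] E →ₗ⋆[ℂ] ℂ} {γ C : ℝ} {w : E}
    (hinfsup : γ * ‖w‖ ≤ ⨆ v : {v : E // v ≠ 0}, ‖B w (v : E)‖ / ‖(v : E)‖)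
    (hw : ∀ v, ‖B w v‖ ≤ C * ‖v‖) : γ * ‖w‖ ≤ C := by
  obtain ⟨v₀, hv₀⟩ := exists_ne (0 : E)
  have : Nonempty {v : E // v ≠ 0} := ⟨⟨v₀, hv₀⟩⟩
  exact hinfsup.trans (ciSup_le fun v => (div_le_iff₀ (norm_pos_iff.2 v.2)).2 (hw v))

/-- **Abstract skeleton of the surrogate a priori error estimate (Theorem 4.1).**
Let `Vh` be a nontrivial finite-dimensional subspace of a complex normed space
`V`, let `A, Ã` be sesquilinear forms on `Vh` and `F` a conjugate-linear
functional. Suppose `u ∈ V` and `u_h ∈ Vh` satisfy `A(u_h, v) = F(v)` for all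
`v ∈ Vh`; that `γ̃ > 0` is a lower inf-sup bound for `Ã`; that
`|A(w,v) − Ã(w,v)| ≤ ε‖w‖‖v‖`; and that `‖u_h‖ ≤ C_s‖u‖`. Then the surrogate
problem `Ã(ũ_h, v) = F(v)` for all `v ∈ Vh` has a unique solution `ũ_h`, and
every solution satisfies `‖u − ũ_h‖ ≤ ‖u − u_h‖ + (εC_s/γ̃)‖u‖`. -/
theorem surrogate_apriori_error_skeleton
    {V : Type*} [NormedAddCommGroup V] [NormedSpace ℂ V]
    (Vh : Submodule ℂ V) [Nontrivial Vh] [FiniteDimensional ℂ Vh]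
    (A A' : Vh →ₗ[ℂ] Vh →ₗ⋆[ℂ] ℂ) (F : Vh →ₗ⋆[ℂ] ℂ)
    (u : V) (uh : Vh) (huh : ∀ v : Vh, A uh v = F v)
    (γ : ℝ) (hγ : 0 < γ)
    (hinfsup : ∀ w : Vh, γ * ‖w‖ ≤
      ⨆ v : {v : Vh // v ≠ 0}, ‖A' w (v : Vh)‖ / ‖(v : Vh)‖)
    (ε : ℝ) (hε : 0 ≤ ε)
    (hpert : ∀ w v : Vh, ‖A w v - A' w v‖ ≤ ε * ‖w‖ * ‖v‖)
    (Cs : ℝ) (hCs : 0 ≤ Cs) (hstab : ‖uh‖ ≤ Cs * ‖u‖) :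
    (∃! tuh : Vh, ∀ v : Vh, A' tuh v = F v) ∧
    (∀ tuh : Vh, (∀ v : Vh, A' tuh v = F v) →
      ‖u - (tuh : V)‖ ≤ ‖u - (uh : V)‖ + (ε * Cs / γ) * ‖u‖) := by
  have hinj : Function.Injective A' := by
    refine (injective_iff_map_eq_zero A').2 fun w hw => ?_
    have h := mul_norm_le_of_infsup (C := 0) (hinfsup w) fun v => by simp [hw]
    exact norm_le_zero_iff.1 (nonpos_of_mul_nonpos_right h hγ)
  refine ⟨?_, fun tuh htuh => ?_⟩
  · obtain ⟨w, hw⟩ := A'.surjective_of_injective_conjDual hinj F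
    exact ⟨w, fun v => by rw [hw], fun y hy => hinj (LinearMap.ext fun v => by rw [hy, hw])⟩
  · have h : γ * ‖tuh - uh‖ ≤ ε * ‖uh‖ :=
      mul_norm_le_of_infsup (hinfsup _) fun v => by
        simpa only [map_sub, LinearMap.sub_apply, htuh, huh] using hpert uh v
    have hdiff : ‖(uh : V) - tuh‖ ≤ ε * Cs / γ * ‖u‖ := by
      rw [norm_sub_rev, div_mul_eq_mul_div, le_div_iff₀' hγ, mul_assoc]
      exact h.trans (mul_le_mul_of_nonneg_left hstab hε)
    exact (norm_sub_le_norm_sub_add_norm_sub u uh tuh).trans (by gcongr)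
end
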